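/- U_q^{tw}(gl_n) is linearly spanned over F by the ordered monomials Π_{i=2}^{2n} s_{i1}^{k_{i1}} s_{i2}^{k_{i2}} ⋯ s_{i,min(i−1,i′)}^{k_{i,min(i−1,i′)}}, i.e. products of powers of the generators s_{ij} taken over all pairs (i,j) with 1 ≤ j < i ≤ j′, arranged in increasing lexicographic order of (i,j), with arbitrary nonnegative integer exponents k_{ij}. -/

import Mathlib

noncomputable section

set_option synthInstance.maxHeartbeats 1000000
set_option maxHeartbeats 1000000

namespace CI

/-- The ground field F = ℂ(q). -/
abbrev F : Type := RatFunc ℂ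

/-- The formal variable q. -/
def q : F := RatFunc.X

/-- The index involution i ↦ i′ = 2n+1−i (here in 0-based form i ↦ 2n−1−i). -/
def pr (n : ℕ) (i : Fin (2*n)) : Fin (2*n) := ⟨2*n - 1 - i.val, by have := i.isLt; omega⟩

/-- ε_i = 1 for i ≤ n and ε_i = −1 for i > n (1-based). -/
def eps (n : ℕ) (i : Fin (2*n)) : F := if (i : ℕ) < n then 1 else -1

/-- (1̄,…,n̄,(n+1)̄,…,(2n)̄) = (n,…,1,−1,…,−n). -/
def bar (n : ℕ) (i : Fin (2*n)) : ℤ :=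
  if (i : ℕ) < n then (n : ℤ) - (i : ℕ) else (n : ℤ) - (i : ℕ) - 1

/-- The diagonal entries of D = diag(qⁿ,…,q,q⁻¹,…,q⁻ⁿ): D_{ii} = q^{ī}. -/
def dd (n : ℕ) (i : Fin (2*n)) : F := q ^ (bar n i)

/-- The entries of the R-matrix R = Σ_{i,j} q^{δ_{ij}−δ_{ij′}} e_{ii} ⊗ e_{jj}
    + (q−q⁻¹) Σ_{i<j} e_{ij} ⊗ e_{ji}
    − (q−q⁻¹) Σ_{i<j} q^{j̄−ī} ε_i ε_j e_{ij} ⊗ e_{i′j′}. -/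
def Rm (n : ℕ) (p s : Fin (2*n) × Fin (2*n)) : F :=
  (if p.1 = s.1 ∧ p.2 = s.2 then
      q ^ ((if p.1 = p.2 then (1:ℤ) else 0) - (if p.1 = pr n p.2 then (1:ℤ) else 0)) else 0)
  + (if p.1 < p.2 ∧ s.1 = p.2 ∧ s.2 = p.1 then q - q⁻¹ else 0)
  - (if p.1 < s.1 ∧ p.2 = pr n p.1 ∧ s.2 = pr n s.1 then
      (q - q⁻¹) * q ^ (bar n s.1 - bar n p.1) * eps n p.1 * eps n s.1 else 0)

/-- Generators t_{ij}, t̄_{ij} of the extended algebra. -/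
inductive Gen (n : ℕ) : Type
  | t (i j : Fin (2*n)) : Gen n
  | tb (i j : Fin (2*n)) : Gen n

/-- The free F-algebra on the generators. -/
abbrev FA (n : ℕ) : Type := FreeAlgebra F (Gen n)

def tF (n : ℕ) (i j : Fin (2*n)) : FA n := FreeAlgebra.ι F (Gen.t i j)
def tbF (n : ℕ) (i j : Fin (2*n)) : FA n := FreeAlgebra.ι F (Gen.tb i j)

/-- The defining relations of the RTT presentation U_q(sp_{2n}): the triangularity
    and diagonal relations, the entrywise RTT relations R T₁ T₂ = T₂ T₁ R,
    R T̄₁ T̄₂ = T̄₂ T̄₁ R, R T̄₁ T₂ = T₂ T̄₁ R, and the entrywise central relations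
    T D Tᵗ D⁻¹ = T̄ D T̄ᵗ D⁻¹ = I, D Tᵗ D⁻¹ T = D T̄ᵗ D⁻¹ T̄ = I
    (where ᵗ is the twisted transposition e_{ij}ᵗ = ε_i ε_j e_{j′i′}). -/
inductive rel (n : ℕ) : FA n → FA n → Prop
  | t_upper (i j : Fin (2*n)) (h : i < j) : rel n (tF n i j) 0
  | tb_lower (i j : Fin (2*n)) (h : j < i) : rel n (tbF n i j) 0
  | t_tb_diag (i : Fin (2*n)) : rel n (tF n i i * tbF n i i) 1
  | tb_t_diag (i : Fin (2*n)) : rel n (tbF n i i * tF n i i) 1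
  | rtt_tt (i a j b : Fin (2*n)) :
      rel n (∑ k, ∑ c, Rm n (i, a) (k, c) • (tF n k j * tF n c b))
            (∑ c, ∑ l, Rm n (l, c) (j, b) • (tF n a c * tF n i l))
  | rtt_bb (i a j b : Fin (2*n)) :
      rel n (∑ k, ∑ c, Rm n (i, a) (k, c) • (tbF n k j * tbF n c b))
            (∑ c, ∑ l, Rm n (l, c) (j, b) • (tbF n a c * tbF n i l))
  | rtt_bt (i a j b : Fin (2*n)) :
      rel n (∑ k, ∑ c, Rm n (i, a) (k, c) • (tbF n k j * tF n c b))
            (∑ c, ∑ l, Rm n (l, c) (j, b) • (tF n a c * tbF n i l))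
  | cent_t1 (i j : Fin (2*n)) :
      rel n (∑ k, (dd n k * (dd n j)⁻¹ * eps n (pr n k) * eps n (pr n j)) •
              (tF n i k * tF n (pr n j) (pr n k)))
            (if i = j then 1 else 0)
  | cent_tb1 (i j : Fin (2*n)) :
      rel n (∑ k, (dd n k * (dd n j)⁻¹ * eps n (pr n k) * eps n (pr n j)) •
              (tbF n i k * tbF n (pr n j) (pr n k)))
            (if i = j then 1 else 0)
  | cent_t2 (i j : Fin (2*n)) :
      rel n (∑ k, (dd n i * (dd n k)⁻¹ * eps n (pr n i) * eps n (pr n k)) •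
              (tF n (pr n k) (pr n i) * tF n k j))
            (if i = j then 1 else 0)
  | cent_tb2 (i j : Fin (2*n)) :
      rel n (∑ k, (dd n i * (dd n k)⁻¹ * eps n (pr n i) * eps n (pr n k)) •
              (tbF n (pr n k) (pr n i) * tbF n k j))
            (if i = j then 1 else 0)

/-- The RTT presentation U_q(sp_{2n}). -/
abbrev Usp (n : ℕ) : Type := RingQuot (rel n)

/-- The generator t_{ij} of U_q(sp_{2n}). -/
def tU (n : ℕ) (i j : Fin (2*n)) : Usp n := RingQuot.mkAlgHom F (rel n) (tF n i j)

/-- The generator t̄_{ij} of U_q(sp_{2n}). -/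
def tbU (n : ℕ) (i j : Fin (2*n)) : Usp n := RingQuot.mkAlgHom F (rel n) (tbF n i j)

/-- The entries s_{ij} = Σ_{k=j}^{i} ε_k t_{ik} t̄_{jk} of the matrix S = T J T̄^u. -/
def sU (n : ℕ) (i j : Fin (2*n)) : Usp n :=
  ∑ k ∈ Finset.Icc j i, eps n k • (tU n i k * tbU n j k)

/-- The entries s̄_{ij} = ε_i ε_j Σ_{k=j}^{i} ε_{k′} t̄_{i′k′} t_{j′k′} of the
    matrix S̄ = T̄^{ut} Jᵗ Tᵗ. -/
def sbU (n : ℕ) (i j : Fin (2*n)) : Usp n :=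
  (eps n i * eps n j) • ∑ k ∈ Finset.Icc j i,
    eps n (pr n k) • (tbU n (pr n i) (pr n k) * tU n (pr n j) (pr n k))

/-- The twisted quantized enveloping algebra U_q^{tw}(gl_n): the subalgebra of
    U_q(sp_{2n}) generated by the entries of S. -/
def Utw (n : ℕ) : Subalgebra F (Usp n) :=
  Algebra.adjoin F (Set.range fun p : Fin (2*n) × Fin (2*n) => sU n p.1 p.2)

/-- The ordered monomial Π_{(i,j) : j < i ≤ j′, lexicographically} s_{ij}^{k_{ij}}:
    the product is taken over increasing i, and for fixed i over increasing j. -/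
def monomial (n : ℕ) (k : Fin (2*n) × Fin (2*n) → ℕ) : Usp n :=
  ((List.finRange (2*n)).map fun i =>
    ((List.finRange (2*n)).map fun j =>
      if j < i ∧ i ≤ pr n j then sU n i j ^ k (i, j) else 1).prod).prod

section Part1
variable {A U ι : Type*} [CommRing A] [Ring U] [Algebra A U]

/-- span of words in the letters satisfying `P`, of total degree at most `d` -/
def Gf (A : Type*) {U ι : Type*} [CommRing A] [Ring U] [Algebra A U]
    (g : ι → U) (dg : ι → ℕ) (P : ι → Prop) (d : ℕ) : Submodule A U :=
  Submodule.span A {x | ∃ L : List ι, (∀ a ∈ L, P a) ∧ (L.map dg).sum ≤ d ∧ x = (L.map g).prod}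

theorem Gf_mono (g : ι → U) (dg : ι → ℕ) {P Q : ι → Prop} (hPQ : ∀ x, P x → Q x) {d e : ℕ}
    (hde : d ≤ e) : Gf A g dg P d ≤ Gf A g dg Q e := by
  apply Submodule.span_mono
  rintro x ⟨L, h1, h2, h3⟩
  exact ⟨L, fun a ha => hPQ a (h1 a ha), h2.trans hde, h3⟩

theorem Gf_one (g : ι → U) (dg : ι → ℕ) (P : ι → Prop) (d : ℕ) : (1 : U) ∈ Gf A g dg P d :=
  Submodule.subset_span ⟨[], by simp, by simp, by simp⟩

theorem Gf_gen (g : ι → U) (dg : ι → ℕ) (P : ι → Prop) {d : ℕ} {x : ι} (hx : P x)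
    (hd : dg x ≤ d) : g x ∈ Gf A g dg P d :=
  Submodule.subset_span ⟨[x], by simpa using hx, by simpa using hd, by simp⟩

theorem Gf_mul (g : ι → U) (dg : ι → ℕ) (P : ι → Prop) {d e : ℕ} {x y : U}
    (hx : x ∈ Gf A g dg P d) (hy : y ∈ Gf A g dg P e) : x * y ∈ Gf A g dg P (d + e) := by
  have h : Gf A g dg P d * Gf A g dg P e ≤ Gf A g dg P (d + e) := by
    unfold Gf
    rw [Submodule.span_mul_span]
    apply Submodule.span_mono
    rintro z ⟨x, ⟨L, h1, h2, rfl⟩, y, ⟨L', h1', h2', rfl⟩, rfl⟩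
    refine ⟨L ++ L', ?_, ?_, ?_⟩
    · intro a ha
      rcases List.mem_append.1 ha with h | h
      · exact h1 a h
      · exact h1' a h
    · simp; omega
    · simp
  exact h (Submodule.mul_mem_mul hx hy)

variable (I : Ideal A)

theorem IGf_mul_right (g : ι → U) (dg : ι → ℕ) (P : ι → Prop) {d e : ℕ} {x y : U}
    (hx : x ∈ I • Gf A g dg P d) (hy : y ∈ Gf A g dg P e) : x * y ∈ I • Gf A g dg P (d + e) := by
  refine Submodule.smul_induction_on hx (fun r hr z hz => ?_) (fun a b ha hb => ?_)
  · rw [smul_mul_assoc]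
    exact Submodule.smul_mem_smul hr (Gf_mul g dg P hz hy)
  · rw [add_mul]; exact add_mem ha hb

theorem IGf_mul_left (g : ι → U) (dg : ι → ℕ) (P : ι → Prop) {d e : ℕ} {x y : U}
    (hx : x ∈ Gf A g dg P d) (hy : y ∈ I • Gf A g dg P e) : x * y ∈ I • Gf A g dg P (d + e) := by
  refine Submodule.smul_induction_on hy (fun r hr z hz => ?_) (fun a b ha hb => ?_)
  · rw [mul_smul_comm]
    exact Submodule.smul_mem_smul hr (Gf_mul g dg P hx hz)
  · rw [mul_add]; exact add_mem ha hb

theorem IGf_mono (g : ι → U) (dg : ι → ℕ) (P : ι → Prop) {d e : ℕ} (h : d ≤ e) :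
    I • Gf A g dg P d ≤ I • Gf A g dg P e :=
  Submodule.smul_mono le_rfl (Gf_mono g dg (fun _ h => h) h)

/-- good words plus `I` times all words -/
def Ef (g : ι → U) (dg : ι → ℕ) (P Q : ι → Prop) (d : ℕ) : Submodule A U :=
  Gf A g dg Q d ⊔ I • Gf A g dg P d

theorem Ef_mul (g : ι → U) (dg : ι → ℕ) {P Q : ι → Prop} (hQP : ∀ x, Q x → P x) {d e : ℕ}
    {x y : U} (hx : x ∈ Ef I g dg P Q d) (hy : y ∈ Ef I g dg P Q e) :
    x * y ∈ Ef I g dg P Q (d + e) := by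
  obtain ⟨x1, hx1, x2, hx2, rfl⟩ := Submodule.mem_sup.1 hx
  obtain ⟨y1, hy1, y2, hy2, rfl⟩ := Submodule.mem_sup.1 hy
  have hx1' : x1 ∈ Gf A g dg P d := Gf_mono g dg hQP le_rfl hx1
  have hy1' : y1 + y2 ∈ Gf A g dg P e :=
    add_mem (Gf_mono g dg hQP le_rfl hy1) (Submodule.smul_le_right hy2)
  rw [add_mul, mul_add, add_assoc]
  exact Submodule.mem_sup.2 ⟨_, Gf_mul g dg Q hx1 hy1, _,
    add_mem (IGf_mul_left I g dg P hx1' hy2) (IGf_mul_right I g dg P hx2 hy1'), rfl⟩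

theorem Ef_mono (g : ι → U) (dg : ι → ℕ) (P Q : ι → Prop) {d e : ℕ} (h : d ≤ e) :
    Ef I g dg P Q d ≤ Ef I g dg P Q e :=
  sup_le_sup (Gf_mono g dg (fun _ h => h) h) (IGf_mono I g dg P h)

theorem perm_mem (g : ι → U) (dg : ι → ℕ) (P : ι → Prop)
    (hcomm : ∀ x y, P x → P y → g x * g y - g y * g x ∈ I • Gf A g dg P (dg x + dg y))
    {L L' : List ι} (h : L.Perm L') : (∀ a ∈ L, P a) →
    (L.map g).prod - (L'.map g).prod ∈ I • Gf A g dg P (L.map dg).sum := by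
  induction h with
  | nil => intro _; simp
  | cons x h ih =>
    rename_i l1 l2
    intro hP
    simp only [List.map_cons, List.prod_cons, List.sum_cons, ← mul_sub]
    exact IGf_mul_left I g dg P (Gf_gen g dg P (hP x (by simp)) le_rfl)
      (ih (fun a ha => hP a (by simp [ha])))
  | swap x y l =>
    intro hP
    simp only [List.map_cons, List.prod_cons, List.sum_cons, ← mul_assoc, ← sub_mul, ← add_assoc]
    refine IGf_mul_right I g dg P (hcomm y x (hP y (by simp)) (hP x (by simp))) ?_
    exact Submodule.subset_span ⟨l, fun a ha => hP a (by simp [ha]), le_rfl, rfl⟩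
  | trans h1 h2 ih1 ih2 =>
    rename_i l1 l2 l3
    intro hP
    have e1 := ih1 hP
    have e2 := ih2 (fun a ha => hP a (h1.mem_iff.2 ha))
    rw [← (h1.map dg).sum_eq] at e2
    have := add_mem e1 e2
    simpa using this

theorem sum_ite_count [DecidableEq ι] (E : List ι) (a : ι) (c : ℕ) :
    (E.map (fun x => if x = a then c else 0)).sum = E.count a * c := by
  induction E with
  | nil => simp
  | cons x l ih =>
    simp only [List.map_cons, List.sum_cons, ih, List.count_cons]
    by_cases h : x = a <;> simp [h]
    ring

theorem part1 [Finite ι] [DecidableEq ι] (hI : I ≤ Ideal.jacobson ⊥) (g : ι → U) (dg : ι → ℕ)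
    {P Q : ι → Prop} (hQP : ∀ x, Q x → P x) (hdg : ∀ x, P x → 0 < dg x)
    (hcomm : ∀ x y, P x → P y → g x * g y - g y * g x ∈ I • Gf A g dg P (dg x + dg y))
    (hsym : ∀ x, P x → (∀ y, P y → dg y < dg x → g y ∈ Ef I g dg P Q (dg y)) →
      g x ∈ Ef I g dg P Q (dg x))
    (E : List ι) (hE : E.Nodup) (hEm : ∀ x, x ∈ E) (d : ℕ) :
    Gf A g dg P d ≤ Submodule.span A {x | ∃ k : ι → ℕ, (∀ y, ¬ Q y → k y = 0) ∧
      x = (E.map fun y => g y ^ k y).prod} := by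
  have hg : ∀ m x, dg x = m → P x → g x ∈ Ef I g dg P Q (dg x) := by
    intro m
    induction m using Nat.strong_induction_on with
    | _ m ih =>
      intro x hx hP
      exact hsym x hP (fun y hy hlt => ih (dg y) (hx ▸ hlt) y rfl hy)
  have hw : ∀ L : List ι, (∀ a ∈ L, P a) → (L.map g).prod ∈ Ef I g dg P Q (L.map dg).sum := by
    intro L
    induction L with
    | nil => intro _; exact Submodule.mem_sup_left (by simpa using Gf_one g dg Q 0)
    | cons x l ih =>
      intro h
      simp only [List.map_cons, List.prod_cons, List.sum_cons]
      exact Ef_mul I g dg hQP (hg _ x rfl (h x (by simp))) (ih fun a ha => h a (by simp [ha]))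
  apply Submodule.le_of_le_smul_of_le_jacobson_bot (I := I) ?_ hI
  · have h1 : Gf A g dg P d ≤ Ef I g dg P Q d := by
      apply Submodule.span_le.2
      rintro x ⟨L, h1, h2, rfl⟩
      exact Ef_mono I g dg P Q h2 (hw L h1)
    refine h1.trans (sup_le ?_ le_sup_right)
    apply Submodule.span_le.2
    rintro x ⟨L, h1, h2, rfl⟩
    set L' := E.flatMap (fun x => List.replicate (L.count x) x) with hL'
    have hperm : L.Perm L' := by
      rw [List.perm_iff_count]
      intro a
      rw [hL', List.count_flatMap]
      have : (E.map (List.count a ∘ fun x => List.replicate (L.count x) x))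
          = E.map (fun x => if x = a then L.count a else 0) := by
        apply List.map_congr_left
        intro x _
        simp only [Function.comp, List.count_replicate]
        by_cases h : x = a <;> simp [h]
      rw [this, sum_ite_count, List.count_eq_one_of_mem hE (hEm a)]
      simp
    have hp := perm_mem I g dg P hcomm hperm (fun a ha => hQP a (h1 a ha))
    have : (L'.map g).prod = (E.map fun y => g y ^ L.count y).prod := by
      rw [hL', List.flatMap_def, List.map_flatten, List.prod_flatten]
      simp [List.map_map, Function.comp_def]
    rw [this] at hp
    have hp' := IGf_mono I g dg P h2 hp
    have := add_mem (Submodule.mem_sup_right (S := Submodule.span A {x | ∃ k : ι → ℕ,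
      (∀ y, ¬ Q y → k y = 0) ∧ x = (E.map fun y => g y ^ k y).prod}) hp')
      (Submodule.mem_sup_left (Submodule.subset_span
        (show (E.map fun y => g y ^ L.count y).prod ∈ _ from ⟨fun y => L.count y, ?_, rfl⟩)))
    · simpa using this
    · intro y hy
      exact List.count_eq_zero_of_not_mem (fun h => hy (h1 y h))
  · refine ⟨(((List.finite_length_le ι d).subset
      (t := {L : List ι | (∀ a ∈ L, P a) ∧ (L.map dg).sum ≤ d}) ?_).image
      (fun L => (L.map g).prod)).toFinset, ?_⟩
    · rintro L ⟨h1, h2⟩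
      have : ∀ L : List ι, (∀ a ∈ L, P a) → L.length ≤ (L.map dg).sum := by
        intro L
        induction L with
        | nil => simp
        | cons x l ih =>
          intro h
          have a1 := ih fun a ha => h a (by simp [ha])
          have a2 := hdg x (h x (by simp))
          simp; omega
      exact (this L h1).trans h2
    · unfold Gf
      congr 1
      ext x
      simp only [Set.Finite.coe_toFinset, Set.mem_image, Set.mem_ofPred_eq]
      constructor
      · rintro ⟨L, ⟨h1, h2⟩, rfl⟩; exact ⟨L, h1, h2, rfl⟩
      · rintro ⟨L, h1, h2, rfl⟩; exact ⟨L, ⟨h1, h2⟩, rfl⟩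

end Part1
section Part2

theorem q_ne : q ≠ 0 := RatFunc.X_ne_zero

theorem pr_val (n : ℕ) (i : Fin (2*n)) : ((pr n i : Fin (2*n)) : ℕ) = 2*n - 1 - i := rfl

theorem pr_pr (n : ℕ) (i : Fin (2*n)) : pr n (pr n i) = i := by
  apply Fin.ext; simp only [pr_val]; have := i.isLt; omega

theorem eq_pr_iff (n : ℕ) (i j : Fin (2*n)) : i = pr n j ↔ j = pr n i := by
  constructor <;> (rintro rfl; rw [pr_pr])

theorem pr_inj (n : ℕ) (i j : Fin (2*n)) : pr n i = pr n j ↔ i = j := by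
  constructor
  · intro h; rw [← pr_pr n i, h, pr_pr]
  · rintro rfl; rfl

theorem pr_ne (n : ℕ) (i : Fin (2*n)) : i ≠ pr n i := by
  intro h
  have h' := congrArg Fin.val h
  simp only [pr_val] at h'
  have := i.isLt; omega

theorem pr_lt (n : ℕ) (i j : Fin (2*n)) : pr n i < pr n j ↔ j < i := by
  simp only [Fin.lt_def, pr_val]; have := i.isLt; have := j.isLt; omega

theorem eps_pr (n : ℕ) (i : Fin (2*n)) : eps n (pr n i) = - eps n i := by
  unfold eps; have := i.isLt; have h2 := pr_val n i
  by_cases h : (i : ℕ) < n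
  · rw [if_pos h, if_neg (by omega)]
  · rw [if_neg h, if_pos (by omega)]; simp

theorem eps_sq (n : ℕ) (i : Fin (2*n)) : eps n i * eps n i = 1 := by
  unfold eps; split_ifs <;> simp

theorem bar_pr (n : ℕ) (i : Fin (2*n)) : bar n (pr n i) = - bar n i := by
  unfold bar; have := i.isLt; have h2 := pr_val n i
  by_cases h : (i : ℕ) < n
  · rw [if_pos h, if_neg (by omega)]; omega
  · rw [if_neg h, if_pos (by omega)]; omega

theorem dd_pr (n : ℕ) (i : Fin (2*n)) : dd n (pr n i) = (dd n i)⁻¹ := by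
  unfold dd; rw [bar_pr, zpow_neg]

theorem dd_ne (n : ℕ) (i : Fin (2*n)) : dd n i ≠ 0 := zpow_ne_zero _ q_ne

/-- R^u = R_21 -/
theorem Rm_symm (n : ℕ) (a b c d : Fin (2*n)) : Rm n (c, d) (a, b) = Rm n (b, a) (d, c) := by
  unfold Rm
  dsimp only
  congr 1
  · congr 1
    · by_cases h : b = d ∧ a = c
      · obtain ⟨rfl, rfl⟩ := h
        simp [eq_comm, eq_pr_iff n b a]
      · rw [if_neg h, if_neg (by tauto)]
    · congr 1
      apply propext
      constructor <;> (rintro ⟨h, rfl, rfl⟩; exact ⟨h, rfl, rfl⟩)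
  · by_cases h : b < d ∧ a = pr n b ∧ c = pr n d
    · obtain ⟨h, rfl, rfl⟩ := h
      rw [if_pos ⟨(pr_lt _ _ _).2 h, (pr_pr _ _).symm, (pr_pr _ _).symm⟩, if_pos ⟨h, rfl, rfl⟩]
      rw [bar_pr, bar_pr, eps_pr, eps_pr, neg_sub_neg]
      ring
    · rw [if_neg h, if_neg]
      rintro ⟨h1, rfl, rfl⟩
      exact h ⟨(pr_lt _ _ _).1 (by rwa [pr_pr, pr_pr] ), by rw [pr_pr], by rw [pr_pr]⟩

theorem Rm_supp (n : ℕ) (i a k c : Fin (2*n)) (h : Rm n (i, a) (k, c) ≠ 0) :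
    (i : ℕ) + a = k + c ∧ i ≤ k := by
  by_contra hc
  apply h
  unfold Rm
  dsimp only
  rw [if_neg, if_neg, if_neg]
  · simp
  · rintro ⟨h1, rfl, rfl⟩
    apply hc
    refine ⟨?_, h1.le⟩
    simp only [pr_val]; have := i.isLt; have := k.isLt; omega
  · rintro ⟨h1, rfl, rfl⟩
    exact hc ⟨by omega, h1.le⟩
  · rintro ⟨rfl, rfl⟩
    exact hc ⟨rfl, le_rfl⟩

theorem Rm_row (n : ℕ) (i a : Fin (2*n)) (g : Fin (2*n) → Fin (2*n) → F) :
    ∑ k, ∑ c, Rm n (i, a) (k, c) * g k c =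
    q ^ ((if i = a then (1:ℤ) else 0) - (if i = pr n a then (1:ℤ) else 0)) * g i a
    + (if i < a then (q - q⁻¹) * g a i else 0)
    - (if a = pr n i then ∑ k, (if i < k then (q - q⁻¹) * q ^ (bar n k - bar n i) * eps n i * eps n k
        * g k (pr n k) else 0) else 0) := by
  unfold Rm
  simp only [sub_mul, add_mul, Finset.sum_sub_distrib, Finset.sum_add_distrib, ite_mul, zero_mul,
    ite_and]
  congr 1
  · congr 1
    · simp
    · by_cases h : i < a <;> simp [h]
  · by_cases h : a = pr n i
    · simp only [h, if_true]
      apply Finset.sum_congr rfl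
      intro k _
      by_cases h : i < k <;> simp [h]
    · simp [h]

theorem Rm_col (n : ℕ) (d f : Fin (2*n)) (g : Fin (2*n) → Fin (2*n) → F) :
    ∑ k, ∑ c, Rm n (k, c) (d, f) * g k c =
    q ^ ((if d = f then (1:ℤ) else 0) - (if d = pr n f then (1:ℤ) else 0)) * g d f
    + (if f < d then (q - q⁻¹) * g f d else 0)
    - (if f = pr n d then ∑ k, (if k < d then (q - q⁻¹) * q ^ (bar n d - bar n k) * eps n k * eps n d
        * g k (pr n k) else 0) else 0) := by
  have h1 : ∑ k, ∑ c, Rm n (k, c) (d, f) * g k c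
      = ∑ c, ∑ k, Rm n (f, d) (c, k) * g k c := by
    rw [Finset.sum_comm]
    simp only [Rm_symm n d f]
  rw [h1, Rm_row n f d (fun c k => g k c)]
  congr 1
  · congr 1
    simp only [eq_comm (a := f) (b := d), eq_pr_iff n f d]
  · by_cases h : f = pr n d
    · subst h
      rw [if_pos (by rw [pr_pr]), if_pos rfl]
      rw [← Equiv.sum_comp (⟨pr n, pr n, pr_pr n, pr_pr n⟩ : Fin (2*n) ≃ Fin (2*n))]
      apply Finset.sum_congr rfl
      intro k _
      simp only [Equiv.coe_fn_mk, pr_lt, pr_pr, bar_pr, eps_pr, neg_sub_neg]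
      congr 1
      ring
    · rw [if_neg h, if_neg]
      intro h2; apply h; rw [h2, pr_pr]

theorem Rm_aux1 (n : ℕ) (d a i f : Fin (2*n)) :
    q ^ ((if i = a then (1:ℤ) else 0) - (if i = pr n a then (1:ℤ) else 0)) * eps n i * eps n f
      * Rm n (d, a) (i, f) =
    q ^ ((if d = f then (1:ℤ) else 0) - (if d = pr n f then (1:ℤ) else 0)) * eps n d * eps n a
      * Rm n (d, a) (i, f) := by
  by_cases h1 : d = i ∧ a = f
  · obtain ⟨rfl, rfl⟩ := h1; rfl
  by_cases h2 : i = a ∧ f = d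
  · obtain ⟨rfl, rfl⟩ := h2
    simp only [if_true, pr_ne, if_false]
    ring
  by_cases h3 : a = pr n d ∧ f = pr n i
  · obtain ⟨rfl, rfl⟩ := h3
    simp only [pr_pr, eps_pr]
    have e1 : (if i = pr n d then (1:ℤ) else 0) = if d = pr n i then (1:ℤ) else 0 := by
      simp only [eq_pr_iff n i d]
    simp only [e1, eq_comm (a := i) (b := d)]
    linear_combination (-(q ^ ((if d = pr n i then (1:ℤ) else 0) - (if d = i then (1:ℤ) else 0))
      * Rm n (d, pr n d) (i, pr n i))) * (eps_sq n i - eps_sq n d)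
  have : Rm n (d, a) (i, f) = 0 := by
    unfold Rm
    dsimp only
    rw [if_neg h1, if_neg, if_neg]
    · simp
    · tauto
    · tauto
  rw [this]; simp

theorem Rm_aux2 (n : ℕ) (d a i f : Fin (2*n)) :
    (if i < a then Rm n (d, i) (a, f) else 0) = (if f < d then Rm n (f, a) (i, d) else 0) := by
  rw [← Rm_symm n a f d i]
  by_cases h0 : Rm n (d, i) (a, f) = 0
  · simp [h0]
  · have := (Rm_supp n d i a f h0).1
    have e : i < a ↔ f < d := by simp only [Fin.lt_def]; omega
    simp only [e]

theorem Rm_aux3 (n : ℕ) (d k f : Fin (2*n)) :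
    Rm n (d, pr n k) (k, f) = if d = k ∧ f = pr n k then q⁻¹ else 0 := by
  unfold Rm
  dsimp only
  rw [if_neg (fun h : d < pr n k ∧ k = pr n k ∧ f = d => pr_ne n k h.2.1),
    if_neg (fun h : d < k ∧ pr n k = pr n d ∧ f = pr n k =>
      absurd ((pr_inj _ _ _).1 h.2.1) h.1.ne')]
  by_cases h : d = k ∧ f = pr n k
  · obtain ⟨rfl, rfl⟩ := h
    simp [pr_ne, pr_pr]
  · rw [if_neg h, if_neg (by rintro ⟨rfl, rfl⟩; exact h ⟨rfl, rfl⟩)]; simp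

theorem Rm_aux4 (n : ℕ) (k a i : Fin (2*n)) :
    Rm n (k, a) (i, pr n k) = if k = i ∧ a = pr n i then q⁻¹ else 0 := by
  unfold Rm
  dsimp only
  rw [if_neg (fun h : k < a ∧ i = a ∧ pr n k = k => pr_ne n k h.2.2.symm),
    if_neg (fun h : k < i ∧ a = pr n k ∧ pr n k = pr n i =>
      absurd ((pr_inj _ _ _).1 h.2.2) h.1.ne)]
  by_cases h : k = i ∧ a = pr n i
  · obtain ⟨rfl, rfl⟩ := h
    simp [pr_ne, pr_pr]
  · rw [if_neg h, if_neg (by rintro ⟨rfl, rfl⟩; exact h ⟨rfl, rfl⟩)]; simp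

/-- The numerical reflection equation for `J`. -/
theorem RJ (n : ℕ) (i a d f : Fin (2*n)) :
    ∑ k, ∑ c, Rm n (i, a) (k, c) * (eps n k * Rm n (d, c) (k, f) * eps n f)
     = ∑ k, ∑ c, Rm n (k, c) (d, f) * (eps n a * Rm n (k, a) (i, c) * eps n k) := by
  rw [Rm_row, Rm_col]
  simp only [Rm_aux3, Rm_aux4]
  have h1 := Rm_aux1 n d a i f
  have h2 := Rm_aux2 n d a i f
  have h2' : (if i < a then (q - q⁻¹) * (eps n a * Rm n (d, i) (a, f) * eps n f) else 0)
      = (if f < d then (q - q⁻¹) * (eps n a * Rm n (f, a) (i, d) * eps n f) else 0) := by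
    have e1 : (if i < a then (q - q⁻¹) * (eps n a * Rm n (d, i) (a, f) * eps n f) else 0)
      = (q - q⁻¹) * eps n a * eps n f * (if i < a then Rm n (d, i) (a, f) else 0) := by
      split_ifs <;> ring
    have e2 : (if f < d then (q - q⁻¹) * (eps n a * Rm n (f, a) (i, d) * eps n f) else 0)
      = (q - q⁻¹) * eps n a * eps n f * (if f < d then Rm n (f, a) (i, d) else 0) := by
      split_ifs <;> ring
    rw [e1, e2, h2]
  rw [h2']
  congr 1
  · congr 1
    linear_combination h1
  · by_cases ha : a = pr n i
    · by_cases hf : f = pr n d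
      · subst ha hf
        rw [if_pos rfl, if_pos rfl, Finset.sum_eq_single d, Finset.sum_eq_single i]
        · by_cases h : i < d
          · simp only [h, if_true, and_self, eps_pr]
            linear_combination (-((q - q⁻¹) * q ^ (bar n d - bar n i) * eps n i * eps n d * q⁻¹))
              * (eps_sq n d - eps_sq n i)
          · simp [h]
        · intro b _ hb
          simp [hb]
        · simp
        · intro b _ hb
          simp [hb.symm]
        · simp
      · rw [if_pos ha, if_neg hf]
        apply Finset.sum_eq_zero
        intro k _
        rw [if_neg (fun h : d = k ∧ f = pr n k => hf (by rw [h.1, h.2]))]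
        simp
    · rw [if_neg ha]
      symm
      split_ifs
      · apply Finset.sum_eq_zero
        intro k _
        rw [if_neg (fun h : k = i ∧ a = pr n i => ha h.2)]
        simp
      · rfl

end Part2
section Part3

set_option linter.unusedSectionVars false
set_option linter.unusedSimpArgs false

/-- the relations of U_q(sp_2n), in an arbitrary algebra -/
structure Rels (n : ℕ) {U : Type*} [Ring U] [Algebra F U] (t tb : Fin (2*n) → Fin (2*n) → U) :
    Prop where
  t_upper (i j : Fin (2*n)) (h : i < j) : t i j = 0
  tb_lower (i j : Fin (2*n)) (h : j < i) : tb i j = 0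
  t_tb_diag (i : Fin (2*n)) : t i i * tb i i = 1
  tb_t_diag (i : Fin (2*n)) : tb i i * t i i = 1
  rtt_tt (i a j b : Fin (2*n)) :
      ∑ k, ∑ c, Rm n (i, a) (k, c) • (t k j * t c b) =
            ∑ c, ∑ l, Rm n (l, c) (j, b) • (t a c * t i l)
  rtt_bb (i a j b : Fin (2*n)) :
      ∑ k, ∑ c, Rm n (i, a) (k, c) • (tb k j * tb c b) =
            ∑ c, ∑ l, Rm n (l, c) (j, b) • (tb a c * tb i l)
  rtt_bt (i a j b : Fin (2*n)) :
      ∑ k, ∑ c, Rm n (i, a) (k, c) • (tb k j * t c b) =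
            ∑ c, ∑ l, Rm n (l, c) (j, b) • (t a c * tb i l)
  cent_t1 (i j : Fin (2*n)) :
      ∑ k, (dd n k * (dd n j)⁻¹ * eps n (pr n k) * eps n (pr n j)) •
              (t i k * t (pr n j) (pr n k)) = if i = j then 1 else 0
  cent_tb2 (i j : Fin (2*n)) :
      ∑ k, (dd n i * (dd n k)⁻¹ * eps n (pr n i) * eps n (pr n k)) •
              (tb (pr n k) (pr n i) * tb k j) = if i = j then 1 else 0

variable {n : ℕ} {U : Type*} [Ring U] [Algebra F U]

def RU (n : ℕ) (U : Type*) [Ring U] [Algebra F U] :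
    Matrix (Fin (2*n) × Fin (2*n)) (Fin (2*n) × Fin (2*n)) U :=
  fun p s => algebraMap F U (Rm n p s)

def RtU (n : ℕ) (U : Type*) [Ring U] [Algebra F U] :
    Matrix (Fin (2*n) × Fin (2*n)) (Fin (2*n) × Fin (2*n)) U :=
  fun p s => algebraMap F U (Rm n (s.1, p.2) (p.1, s.2))

def X1 (X : Fin (2*n) → Fin (2*n) → U) :
    Matrix (Fin (2*n) × Fin (2*n)) (Fin (2*n) × Fin (2*n)) U :=
  fun p s => if p.2 = s.2 then X p.1 s.1 else 0

def X2 (X : Fin (2*n) → Fin (2*n) → U) :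
    Matrix (Fin (2*n) × Fin (2*n)) (Fin (2*n) × Fin (2*n)) U :=
  fun p s => if p.1 = s.1 then X p.2 s.2 else 0

def JU (n : ℕ) (U : Type*) [Ring U] [Algebra F U] : Fin (2*n) → Fin (2*n) → U :=
  fun i j => if i = j then algebraMap F U (eps n i) else 0

local notation "MU" => Matrix (Fin (2*n) × Fin (2*n)) (Fin (2*n) × Fin (2*n)) U

theorem X1_mul (X : Fin (2*n) → Fin (2*n) → U) (M : MU) (i a : Fin (2*n)) (s) :
    (X1 X * M) (i, a) s = ∑ k, X i k * M (k, a) s := by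
  simp [Matrix.mul_apply, Fintype.sum_prod_type, X1]

theorem X2_mul (X : Fin (2*n) → Fin (2*n) → U) (M : MU) (i a : Fin (2*n)) (s) :
    (X2 X * M) (i, a) s = ∑ k, X a k * M (i, k) s := by
  simp [Matrix.mul_apply, Fintype.sum_prod_type, X2]

theorem mul_X1 (X : Fin (2*n) → Fin (2*n) → U) (M : MU) (i a : Fin (2*n)) (s) :
    (M * X1 X) s (i, a) = ∑ k, M s (k, a) * X k i := by
  simp [Matrix.mul_apply, Fintype.sum_prod_type, X1]

theorem mul_X2 (X : Fin (2*n) → Fin (2*n) → U) (M : MU) (i a : Fin (2*n)) (s) :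
    (M * X2 X) s (i, a) = ∑ k, M s (i, k) * X k a := by
  simp [Matrix.mul_apply, Fintype.sum_prod_type, X2]

theorem RU_mul (M : MU) (p s) :
    (RU n U * M) p s = ∑ k, ∑ c, Rm n p (k, c) • M (k, c) s := by
  simp [Matrix.mul_apply, Fintype.sum_prod_type, RU, Algebra.smul_def]

theorem mul_RU (M : MU) (p s) :
    (M * RU n U) p s = ∑ k, ∑ c, Rm n (k, c) s • M p (k, c) := by
  simp [Matrix.mul_apply, Fintype.sum_prod_type, RU, Algebra.smul_def, Algebra.commutes]

theorem RtU_mul (M : MU) (i a s) :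
    (RtU n U * M) (i, a) s = ∑ k, ∑ c, Rm n (k, a) (i, c) • M (k, c) s := by
  simp [Matrix.mul_apply, Fintype.sum_prod_type, RtU, Algebra.smul_def]

theorem RU_apply (p s) : RU n U p s = algebraMap F U (Rm n p s) := rfl
theorem RtU_apply (i a j b) : RtU n U (i, a) (j, b) = algebraMap F U (Rm n (j, a) (i, b)) := rfl
theorem X1_apply (X : Fin (2*n) → Fin (2*n) → U) (i a j b) :
  X1 X (i, a) (j, b) = if a = b then X i j else 0 := rfl
theorem X2_apply (X : Fin (2*n) → Fin (2*n) → U) (i a j b) :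
  X2 X (i, a) (j, b) = if i = j then X a b else 0 := rfl

theorem J1_comm (X : Fin (2*n) → Fin (2*n) → U) : X1 (JU n U) * X2 X = X2 X * X1 (JU n U) := by
  ext ⟨i, a⟩ ⟨j, b⟩
  rw [X1_mul, X2_mul]
  simp only [X1_apply, X2_apply, JU]
  simp only [ite_mul, mul_ite, zero_mul, mul_zero, Finset.sum_ite_eq, Finset.mem_univ, if_true,
    Finset.sum_ite_eq']
  split_ifs
  · exact Algebra.commutes _ _
  · rfl

theorem J2_comm (X : Fin (2*n) → Fin (2*n) → U) : X2 (JU n U) * X1 X = X1 X * X2 (JU n U) := by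
  ext ⟨i, a⟩ ⟨j, b⟩
  rw [X1_mul, X2_mul]
  simp only [X1_apply, X2_apply, JU]
  simp only [ite_mul, mul_ite, zero_mul, mul_zero, Finset.sum_ite_eq, Finset.mem_univ, if_true,
    Finset.sum_ite_eq']
  split_ifs
  · exact Algebra.commutes _ _
  · rfl

theorem J_RE : RU n U * X1 (JU n U) * RtU n U * X2 (JU n U)
    = X2 (JU n U) * RtU n U * X1 (JU n U) * RU n U := by
  ext ⟨i, a⟩ ⟨d, f⟩
  rw [mul_X2, mul_RU]
  have h1 : ∀ k, (RU n U * X1 (JU n U) * RtU n U) (i, a) (d, k)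
      = ∑ x, ∑ c, algebraMap F U (Rm n (i, a) (x, c) * (eps n x * Rm n (d, c) (x, k))) := by
    intro k
    rw [mul_assoc, RU_mul]
    simp only [X1_mul, RtU_apply, JU]
    simp [Algebra.smul_def]
  have h2 : ∀ k c, (X2 (JU n U) * RtU n U * X1 (JU n U)) (i, a) (k, c)
      = algebraMap F U (eps n a * Rm n (k, a) (i, c) * eps n k) := by
    intro k c
    rw [mul_X1]
    simp only [X2_mul, RtU_apply, JU]
    simp
  simp only [h1, h2, JU, mul_ite, mul_zero, Finset.sum_ite_eq', Finset.mem_univ, if_true]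
  have := congrArg (algebraMap F U) (RJ n i a d f)
  simp only [map_sum] at this
  simp only [Algebra.smul_def, ← map_mul, ← map_sum] at this ⊢
  rw [← this]
  congr 1
  simp only [Finset.sum_mul]
  apply Finset.sum_congr rfl; intro x _
  apply Finset.sum_congr rfl; intro c _
  ring

variable {t tb : Fin (2*n) → Fin (2*n) → U}

theorem e1 (h : Rels n t tb) : RU n U * X1 t * X2 t = X2 t * X1 t * RU n U := by
  ext ⟨i, a⟩ ⟨j, b⟩
  rw [mul_assoc, RU_mul, mul_RU]
  simp only [X1_mul, X2_mul, X1_apply, X2_apply]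
  have := h.rtt_tt i a j b
  simp only [mul_ite, mul_zero, Finset.sum_ite_eq', Finset.sum_ite_eq, Finset.mem_univ, if_true]
  rw [this, Finset.sum_comm]

theorem e3 (h : Rels n t tb) : RU n U * X1 (fun i j => tb j i) * X2 (fun i j => tb j i)
    = X2 (fun i j => tb j i) * X1 (fun i j => tb j i) * RU n U := by
  ext ⟨i, a⟩ ⟨j, b⟩
  rw [mul_assoc, RU_mul, mul_RU]
  simp only [X1_mul, X2_mul, X1_apply, X2_apply]
  have := h.rtt_bb b j a i
  simp only [mul_ite, mul_zero, Finset.sum_ite_eq', Finset.sum_ite_eq, Finset.mem_univ, if_true]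
  rw [Finset.sum_comm (γ := Fin (2*n))] at this
  simp only [Rm_symm n a i] at this
  rw [← this]
  apply Finset.sum_congr rfl; intro x _
  apply Finset.sum_congr rfl; intro c _
  rw [Rm_symm]

theorem e2 (h : Rels n t tb) : X1 (fun i j => tb j i) * (RtU n U * X2 t)
    = X2 t * (RtU n U * X1 (fun i j => tb j i)) := by
  ext ⟨j, a⟩ ⟨i, b⟩
  rw [X1_mul, X2_mul]
  simp only [mul_X1, mul_X2, RtU_apply]
  have := h.rtt_bt i a j b
  simp only [Finset.mul_sum]
  simp only [Algebra.smul_def] at this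
  convert this using 1
  · apply Finset.sum_congr rfl; intro x _
    apply Finset.sum_congr rfl; intro c _
    rw [← mul_assoc, ← Algebra.commutes, mul_assoc]
  · apply Finset.sum_congr rfl; intro x _
    apply Finset.sum_congr rfl; intro c _
    rw [← mul_assoc, ← Algebra.commutes, mul_assoc]

theorem e4 (h : Rels n t tb) : X1 t * (RtU n U * X2 (fun i j => tb j i))
    = X2 (fun i j => tb j i) * (RtU n U * X1 t) := by
  ext ⟨i, a⟩ ⟨j, b⟩
  rw [X1_mul, X2_mul]
  simp only [mul_X1, mul_X2, RtU_apply]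
  have := h.rtt_bt b i a j
  simp only [Finset.mul_sum]
  simp only [Algebra.smul_def] at this
  symm
  convert this using 1
  · apply Finset.sum_congr rfl; intro x _
    apply Finset.sum_congr rfl; intro c _
    rw [← mul_assoc, ← Algebra.commutes, mul_assoc, Rm_symm]
  · apply Finset.sum_congr rfl; intro x _
    apply Finset.sum_congr rfl; intro c _
    rw [← mul_assoc, ← Algebra.commutes, mul_assoc, Rm_symm]

theorem RE_monoid {G : Type*} [Monoid G] {R Rt T1 T2 B1 B2 J1 J2 : G}
    (h1 : R * T1 * T2 = T2 * T1 * R) (h3 : R * B1 * B2 = B2 * B1 * R)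
    (h2 : B1 * (Rt * T2) = T2 * (Rt * B1)) (h4 : T1 * (Rt * B2) = B2 * (Rt * T1))
    (c1 : J1 * T2 = T2 * J1) (c2 : J2 * B1 = B1 * J2) (c3 : J2 * T1 = T1 * J2)
    (c4 : J1 * B2 = B2 * J1) (hJ : R * J1 * Rt * J2 = J2 * Rt * J1 * R) :
    R * (T1 * J1 * B1) * Rt * (T2 * J2 * B2) = (T2 * J2 * B2) * Rt * (T1 * J1 * B1) * R := by
  calc R * (T1 * J1 * B1) * Rt * (T2 * J2 * B2)
      = R * T1 * J1 * (B1 * (Rt * T2)) * J2 * B2 := by simp only [mul_assoc]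
    _ = R * T1 * (J1 * T2) * Rt * (B1 * J2) * B2 := by rw [h2]; simp only [mul_assoc]
    _ = (R * T1 * T2) * J1 * Rt * J2 * B1 * B2 := by rw [c1, ← c2]; simp only [mul_assoc]
    _ = T2 * T1 * (R * J1 * Rt * J2) * B1 * B2 := by rw [h1]; simp only [mul_assoc]
    _ = T2 * T1 * J2 * Rt * J1 * (R * B1 * B2) := by rw [hJ]; simp only [mul_assoc]
    _ = T2 * (T1 * J2) * Rt * (J1 * B2) * B1 * R := by rw [h3]; simp only [mul_assoc]
    _ = T2 * J2 * (T1 * (Rt * B2)) * J1 * B1 * R := by rw [← c3, c4]; simp only [mul_assoc]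
    _ = _ := by rw [h4]; simp only [mul_assoc]

/-- s_{ij} -/
def sg (n : ℕ) {U : Type*} [Ring U] [Algebra F U] (t tb : Fin (2*n) → Fin (2*n) → U)
    (i j : Fin (2*n)) : U := ∑ k, eps n k • (t i k * tb j k)

/-- s'_{ij} -/
def sp (n : ℕ) {U : Type*} [Ring U] [Algebra F U] (t tb : Fin (2*n) → Fin (2*n) → U)
    (i j : Fin (2*n)) : U := ∑ k, eps n k • (tb i k * t j k)

theorem S1_eq : X1 (sg n t tb) = X1 t * X1 (JU n U) * X1 (fun i j => tb j i) := by
  ext ⟨i, a⟩ ⟨j, b⟩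
  rw [mul_assoc, X1_mul]
  simp only [X1_mul, X1_apply, JU, sg]
  by_cases h : a = b <;> simp [h, Algebra.smul_def]
  apply Finset.sum_congr rfl; intro x _
  rw [← mul_assoc, Algebra.commutes, mul_assoc]

theorem S2_eq : X2 (sg n t tb) = X2 t * X2 (JU n U) * X2 (fun i j => tb j i) := by
  ext ⟨i, a⟩ ⟨j, b⟩
  rw [mul_assoc, X2_mul]
  simp only [X2_mul, X2_apply, JU, sg]
  by_cases h : i = j <;> simp [h, Algebra.smul_def]
  apply Finset.sum_congr rfl; intro x _
  rw [← mul_assoc, Algebra.commutes, mul_assoc]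

/-- The reflection equation -/
theorem RE (h : Rels n t tb) (i a d f : Fin (2*n)) :
    ∑ k, ∑ c, ∑ b, ∑ e, (Rm n (i, a) (k, c) * Rm n (d, c) (b, e)) • (sg n t tb k b * sg n t tb e f)
    = ∑ c, ∑ k, ∑ e, ∑ m, (Rm n (k, c) (i, e) * Rm n (m, e) (d, f)) •
      (sg n t tb a c * sg n t tb k m) := by
  have H := RE_monoid (e1 h) (e3 h) (e2 h) (e4 h) (J1_comm t) (J2_comm _) (J2_comm t) (J1_comm _)
    (J_RE (n := n) (U := U))
  rw [← S1_eq, ← S2_eq] at H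
  have H' := congrFun (congrFun H (i, a)) (d, f)
  have l : (RU n U * X1 (sg n t tb) * RtU n U * X2 (sg n t tb)) (i, a) (d, f) =
    ∑ k, ∑ c, ∑ b, ∑ e, (Rm n (i, a) (k, c) * Rm n (d, c) (b, e)) •
      (sg n t tb k b * sg n t tb e f) := by
    rw [mul_assoc, mul_assoc, RU_mul]
    simp only [X1_mul, mul_X2, RtU_apply]
    simp only [Finset.mul_sum, Finset.smul_sum, mul_smul]
    apply Finset.sum_congr rfl; intro x _
    apply Finset.sum_congr rfl; intro c _
    apply Finset.sum_congr rfl; intro y _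
    apply Finset.sum_congr rfl; intro z _
    congr 1
    rw [Algebra.smul_def, ← mul_assoc, ← Algebra.commutes, mul_assoc]
  have r : (X2 (sg n t tb) * RtU n U * X1 (sg n t tb) * RU n U) (i, a) (d, f) =
    ∑ c, ∑ k, ∑ e, ∑ m, (Rm n (k, c) (i, e) * Rm n (m, e) (d, f)) •
      (sg n t tb a c * sg n t tb k m) := by
    rw [mul_RU]
    simp only [mul_assoc (X2 (sg n t tb))]
    simp only [X2_mul, mul_X1, RtU_apply]
    simp only [Finset.mul_sum, Finset.smul_sum]
    have : ∀ G : Fin (2*n) → Fin (2*n) → Fin (2*n) → Fin (2*n) → U,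
      ∑ c, ∑ k, ∑ e, ∑ m, G c k e m = ∑ m, ∑ e, ∑ c, ∑ k, G c k e m := by
      intro G
      have h1 : ∀ c, ∑ k, ∑ e, ∑ m, G c k e m = ∑ m, ∑ e, ∑ k, G c k e m := by
        intro c
        rw [Finset.sum_comm]
        rw [Finset.sum_comm (s := Finset.univ) (t := Finset.univ) (f := fun m e => ∑ k, G c k e m)]
        apply Finset.sum_congr rfl; intro e _
        rw [Finset.sum_comm]
      simp only [h1]
      rw [Finset.sum_comm]
      apply Finset.sum_congr rfl; intro m _
      rw [Finset.sum_comm]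
    symm
    rw [this]
    symm
    apply Finset.sum_congr rfl; intro x _
    apply Finset.sum_congr rfl; intro c _
    apply Finset.sum_congr rfl; intro y _
    apply Finset.sum_congr rfl; intro z _
    rw [mul_comm (Rm n _ _), mul_smul]
    congr 1
    rw [Algebra.smul_def, ← mul_assoc, ← Algebra.commutes, mul_assoc]
  rw [← l, ← r]
  exact H'

/-- linear relation between s' and s -/
theorem sp_lin (h : Rels n t tb) (i a : Fin (2*n)) :
    ∑ k, ∑ c, Rm n (i, a) (k, c) • sp n t tb k c = q • sg n t tb a i := by
  have h1 : ∑ j, eps n j • ∑ k, ∑ c, Rm n (i, a) (k, c) • (tb k j * t c j)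
      = ∑ j, eps n j • ∑ c, ∑ l, Rm n (l, c) (j, j) • (t a c * tb i l) := by
    simp only [h.rtt_bt]
  have hR : ∀ l c j, Rm n (l, c) (j, j) = if l = j ∧ c = j then q else 0 := by
    intro l c j
    unfold Rm
    dsimp only
    rw [if_neg (fun h : l < c ∧ j = c ∧ j = l => absurd (h.2.1.symm.trans h.2.2) h.1.ne'),
      if_neg (fun h : l < j ∧ c = pr n l ∧ j = pr n j => pr_ne n j h.2.2)]
    by_cases hh : l = j ∧ c = j
    · obtain ⟨rfl, rfl⟩ := hh
      simp [pr_ne]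
    · simp [hh]
  simp only [hR] at h1
  have h2 : ∑ j, eps n j • ∑ c, ∑ l, (if l = j ∧ c = j then q else 0) • (t a c * tb i l)
      = q • sg n t tb a i := by
    unfold sg
    rw [Finset.smul_sum]
    apply Finset.sum_congr rfl; intro j _
    simp only [ite_smul, zero_smul, ite_and]
    simp only [Finset.sum_ite_eq', Finset.mem_univ, if_true]
    rw [smul_comm]
  rw [← h2, ← h1]
  unfold sp
  simp only [Finset.smul_sum]
  symm
  rw [Finset.sum_comm]
  apply Finset.sum_congr rfl; intro k _
  rw [Finset.sum_comm]
  apply Finset.sum_congr rfl; intro c _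
  apply Finset.sum_congr rfl; intro j _
  rw [smul_comm]

/-- quadratic relation between s and s' -/
theorem sp_quad (h : Rels n t tb) (i b : Fin (2*n)) (hib : i ≠ pr n b) :
    ∑ j, (dd n j * eps n j) • (sg n t tb i j * sp n t tb (pr n j) b) = 0 := by
  have ht : ∀ p l, ∑ j, (dd n j * eps n j) • (tb j p * tb (pr n j) l)
      = if l = pr n p then algebraMap F U (dd n p * eps n p) else 0 := by
    intro p l
    have h1 := h.cent_tb2 (pr n p) l
    rw [← Equiv.sum_comp (⟨pr n, pr n, pr_pr n, pr_pr n⟩ : Fin (2*n) ≃ Fin (2*n))] at h1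
    simp only [Equiv.coe_fn_mk, pr_pr, dd_pr, inv_inv] at h1
    have h2 := congrArg (fun x => (dd n p * eps n p) • x) h1
    simp only [Finset.smul_sum, smul_smul] at h2
    rw [show (if l = pr n p then algebraMap F U (dd n p * eps n p) else 0)
      = (dd n p * eps n p) • (if pr n p = l then (1:U) else 0) by
        by_cases hh : l = pr n p
        · simp [hh, Algebra.smul_def]
        · simp [hh, Ne.symm hh], ← h2]
    apply Finset.sum_congr rfl; intro j _
    congr 1
    have := eps_sq n p
    have := dd_ne n p
    field_simp
    linear_combination (-(dd n j * eps n j)) * eps_sq n p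
  have key : ∑ j, (dd n j * eps n j) • (sg n t tb i j * sp n t tb (pr n j) b)
      = ∑ k, (dd n k * eps n (pr n k)) • (t i k * t b (pr n k)) := by
    have e1 : ∀ j, (dd n j * eps n j) • (sg n t tb i j * sp n t tb (pr n j) b)
        = ∑ k, ∑ l, (eps n k * eps n l) • (t i k * ((dd n j * eps n j) • (tb j k * tb (pr n j) l))
          * t b l) := by
      intro j
      unfold sg sp
      rw [Finset.sum_mul_sum, Finset.smul_sum]
      apply Finset.sum_congr rfl; intro k _
      rw [Finset.smul_sum]
      apply Finset.sum_congr rfl; intro l _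
      simp only [smul_mul_assoc, mul_smul_comm, smul_smul, mul_assoc]
      congr 1
      ring
    simp only [e1]
    rw [Finset.sum_comm]
    apply Finset.sum_congr rfl; intro k _
    rw [Finset.sum_comm]
    simp only [← Finset.smul_sum, ← Finset.mul_sum, ← Finset.sum_mul, ht]
    simp only [mul_ite, mul_zero, ite_mul, zero_mul, smul_ite, smul_zero, Finset.sum_ite_eq',
      Finset.sum_ite_eq, Finset.mem_univ, if_true]
    rw [← Algebra.commutes, ← Algebra.smul_def, smul_mul_assoc, smul_smul]
    congr 1
    rw [eps_pr]
    linear_combination (-(dd n k * eps n k)) * eps_sq n k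
  rw [key]
  have h1 := h.cent_t1 i (pr n b)
  rw [if_neg hib] at h1
  simp only [pr_pr] at h1
  have h2 := congrArg (fun x => (dd n (pr n b) * eps n b) • x) h1
  simp only [Finset.smul_sum, smul_smul, smul_zero] at h2
  rw [← h2]
  apply Finset.sum_congr rfl; intro j _
  congr 1
  have := dd_ne n (pr n b)
  field_simp
  linear_combination (-(dd n j * eps n (pr n j))) * eps_sq n b

theorem sg_zero (h : Rels n t tb) {i j : Fin (2*n)} (hij : i < j) : sg n t tb i j = 0 := by
  apply Finset.sum_eq_zero
  intro k _
  rcases lt_or_ge i k with hk | hk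
  · rw [h.t_upper _ _ hk]; simp
  · rw [h.tb_lower _ _ (hk.trans_lt hij)]; simp

theorem sp_zero (h : Rels n t tb) {i j : Fin (2*n)} (hij : j < i) : sp n t tb i j = 0 := by
  apply Finset.sum_eq_zero
  intro k _
  rcases lt_or_ge j k with hk | hk
  · rw [h.t_upper _ _ hk]; simp
  · rw [h.tb_lower _ _ (hk.trans_lt hij)]; simp

theorem sg_diag (h : Rels n t tb) (i : Fin (2*n)) : sg n t tb i i = eps n i • 1 := by
  unfold sg
  rw [Finset.sum_eq_single i, h.t_tb_diag]
  · intro k _ hk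
    rcases lt_or_gt_of_ne hk with hk | hk
    · rw [h.tb_lower _ _ hk]; simp
    · rw [h.t_upper _ _ hk]; simp
  · simp

theorem sp_diag (h : Rels n t tb) (i : Fin (2*n)) : sp n t tb i i = eps n i • 1 := by
  unfold sp
  rw [Finset.sum_eq_single i, h.tb_t_diag]
  · intro k _ hk
    rcases lt_or_gt_of_ne hk with hk | hk
    · rw [h.tb_lower _ _ hk]; simp
    · rw [h.t_upper _ _ hk]; simp
  · simp

end Part3
section Part4

variable {n : ℕ} {U : Type*} [Ring U] [Algebra F U]
variable {Γ : Type*} [LinearOrderedCommGroupWithZero Γ] {v : Valuation F Γ}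

theorem v_q (hv : v (q - 1) < 1) : v q = 1 := by
  have : q = 1 + (q - 1) := by ring
  rw [this]
  exact Valuation.map_one_add_of_lt v hv

theorem v_qz (hv : v (q - 1) < 1) (m : ℤ) : v (q ^ m) = 1 := by
  rw [map_zpow₀, v_q hv, one_zpow]

theorem v_qinv (hv : v (q - 1) < 1) : v (q⁻¹) = 1 := by
  rw [map_inv₀, v_q hv, inv_one]

theorem v_add_lt {x y : F} (hx : v x < 1) (hy : v y < 1) : v (x + y) < 1 :=
  Valuation.map_add_lt v hx hy

theorem v_sub_lt {x y : F} (hx : v x < 1) (hy : v y < 1) : v (x - y) < 1 :=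
  Valuation.map_sub_lt v hx hy

theorem v_mul_lt {x y : F} (hx : v x < 1) (hy : v y ≤ 1) : v (x * y) < 1 := by
  rw [map_mul]
  exact mul_lt_one_of_lt_of_le hx hy

theorem v_qinv1 (hv : v (q - 1) < 1) : v (q⁻¹ - 1) < 1 := by
  have : q⁻¹ - 1 = (q - 1) * (- q⁻¹) := by
    have := q_ne
    field_simp; ring
  rw [this]
  apply v_mul_lt hv
  rw [Valuation.map_neg, v_qinv hv]

theorem v_lam (hv : v (q - 1) < 1) : v (q - q⁻¹) < 1 := by
  have : q - q⁻¹ = (q - 1) - (q⁻¹ - 1) := by ring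
  rw [this]
  exact v_sub_lt hv (v_qinv1 hv)

theorem v_eps (i : Fin (2*n)) : v (eps n i) = 1 := by
  unfold eps; split_ifs <;> simp

theorem v_dd (hv : v (q - 1) < 1) (i : Fin (2*n)) : v (dd n i) = 1 := v_qz hv _

theorem v_Rm (hv : v (q - 1) < 1) (p s : Fin (2*n) × Fin (2*n)) :
    v (Rm n p s - if p = s then 1 else 0) < 1 := by
  unfold Rm
  have h1 : v ((if p.1 = s.1 ∧ p.2 = s.2 then
      q ^ ((if p.1 = p.2 then (1:ℤ) else 0) - (if p.1 = pr n p.2 then (1:ℤ) else 0)) else 0)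
      - if p = s then 1 else 0) < 1 := by
    by_cases h : p = s
    · subst h
      simp only [and_self, if_true]
      split_ifs
      · simp
      · simpa using hv
      · simpa using v_qinv1 hv
      · simp
    · rw [if_neg h, if_neg (by intro hh; exact h (Prod.ext hh.1 hh.2))]
      simp
  have h2 : v (if p.1 < p.2 ∧ s.1 = p.2 ∧ s.2 = p.1 then q - q⁻¹ else 0) < 1 := by
    split_ifs
    · exact v_lam hv
    · simp
  have h3 : v (if p.1 < s.1 ∧ p.2 = pr n p.1 ∧ s.2 = pr n s.1 then
      (q - q⁻¹) * q ^ (bar n s.1 - bar n p.1) * eps n p.1 * eps n s.1 else 0) < 1 := by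
    split_ifs
    · refine v_mul_lt (v_mul_lt (v_mul_lt (v_lam hv) ?_) ?_) ?_
      · rw [v_qz hv]
      · rw [v_eps]
      · rw [v_eps]
    · simp
  have := v_sub_lt (v_add_lt h1 h2) h3
  convert this using 2
  ring

theorem v_Rm_le (hv : v (q - 1) < 1) (p s : Fin (2*n) × Fin (2*n)) : v (Rm n p s) ≤ 1 := by
  have h := v_Rm hv p s
  have : Rm n p s = (Rm n p s - if p = s then 1 else 0) + if p = s then 1 else 0 := by ring
  rw [this]
  refine Valuation.map_add_le v h.le ?_
  split_ifs <;> simp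

theorem v_RR (hv : v (q - 1) < 1) (p s p' s' : Fin (2*n) × Fin (2*n)) :
    v (Rm n p s * Rm n p' s' - if p = s ∧ p' = s' then 1 else 0) < 1 := by
  have h1 := v_mul_lt (v_Rm hv p s) (v_Rm_le hv p' s')
  have h2 : v ((Rm n p' s' - if p' = s' then 1 else 0) * if p = s then 1 else 0) < 1 := by
    apply v_mul_lt (v_Rm hv p' s')
    split_ifs <;> simp
  convert v_add_lt h1 h2 using 2
  by_cases e1 : p = s <;> by_cases e2 : p' = s' <;> simp [e1, e2] <;> ring

end Part4

section Part5
variable {n : ℕ} {U : Type*} [Ring U] [Algebra F U]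
variable {Γ : Type*} [LinearOrderedCommGroupWithZero Γ] {v : Valuation F Γ}
variable {t tb : Fin (2*n) → Fin (2*n) → U}
variable [Algebra v.valuationSubring U] [IsScalarTower v.valuationSubring F U]

theorem smul_mem_sub (M : Submodule v.valuationSubring U) {c : F} (hc : v c ≤ 1) {x : U}
    (hx : x ∈ M) : c • x ∈ M := by
  have : c • x = (⟨c, hc⟩ : v.valuationSubring) • x := by
    rw [← algebraMap_smul F (⟨c, hc⟩ : v.valuationSubring) x]; rfl
  rw [this]
  exact M.smul_mem _ hx

theorem smul_mem_I (M : Submodule v.valuationSubring U) {c : F} (hc : v c < 1) {x : U}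
    (hx : x ∈ M) : c • x ∈ IsLocalRing.maximalIdeal v.valuationSubring • M := by
  have : c • x = (⟨c, hc.le⟩ : v.valuationSubring) • x := by
    rw [← algebraMap_smul F (⟨c, hc.le⟩ : v.valuationSubring) x]; rfl
  rw [this]
  refine Submodule.smul_mem_smul ?_ hx
  rw [IsLocalRing.mem_maximalIdeal, mem_nonunits_iff]
  rintro ⟨w, hw⟩
  have h1 : (w : v.valuationSubring) * ((w⁻¹ : (v.valuationSubring)ˣ) : v.valuationSubring) = 1 :=
    w.mul_inv
  have h2 := congrArg (fun x : v.valuationSubring => v (x : F)) h1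
  rw [hw] at h2
  simp only [MulMemClass.coe_mul, map_mul, OneMemClass.coe_one, map_one] at h2
  have h3 : v (((w⁻¹ : (v.valuationSubring)ˣ) : v.valuationSubring) : F) ≤ 1 :=
    (((w⁻¹ : (v.valuationSubring)ˣ) : v.valuationSubring)).2
  exact absurd h2 (mul_lt_one_of_lt_of_le hc h3).ne

local notation "gg" => (fun p : Fin (2*n) × Fin (2*n) => sg n t tb (Prod.fst p) (Prod.snd p))
local notation "dg" => (fun p : Fin (2*n) × Fin (2*n) => Fin.val (Prod.fst p) - Fin.val (Prod.snd p))
local notation "PP" => (fun p : Fin (2*n) × Fin (2*n) => Prod.snd p < Prod.fst p)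
local notation "QQ" => (fun p : Fin (2*n) × Fin (2*n) => Prod.snd p < Prod.fst p ∧ Prod.fst p ≤ pr n (Prod.snd p))
local notation "AA" => v.valuationSubring
local notation "II" => IsLocalRing.maximalIdeal v.valuationSubring

theorem sM (h : Rels n t tb) {i j : Fin (2*n)} {d : ℕ} (hd : (i : ℕ) ≤ d + j) :
    sg n t tb i j ∈ Gf AA gg dg PP d := by
  rcases lt_trichotomy i j with hij | hij | hij
  · rw [sg_zero h hij]; exact zero_mem _
  · subst hij
    rw [sg_diag h]
    exact smul_mem_sub _ (v_eps i).le (Gf_one _ _ _ _)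
  · exact Gf_gen gg dg PP (x := (i, j)) hij (by dsimp only; omega)

theorem sMM (h : Rels n t tb) {i j k l : Fin (2*n)} {d : ℕ} (hd : (i : ℕ) + k ≤ d + j + l) :
    sg n t tb i j * sg n t tb k l ∈ Gf AA gg dg PP d := by
  rcases lt_or_ge i j with hij | hij
  · rw [sg_zero h hij, zero_mul]; exact zero_mem _
  rcases lt_or_ge k l with hkl | hkl
  · rw [sg_zero h hkl, mul_zero]; exact zero_mem _
  rw [Fin.le_def] at hij hkl
  refine Gf_mono gg dg (fun _ h => h) ?_ (Gf_mul gg dg PP (sM h (d := i - j) ?_)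
    (sM h (d := k - l) ?_)) <;> omega

theorem comm_mem (hv : v (q - 1) < 1) (h : Rels n t tb) (i d a f : Fin (2*n)) {D : ℕ}
    (hD : (i : ℕ) + a ≤ D + d + f) :
    sg n t tb i d * sg n t tb a f - sg n t tb a f * sg n t tb i d ∈ II • Gf AA gg dg PP D := by
  have H := RE h i a d f
  have h1 : ∑ k, ∑ c, ∑ b, ∑ e, (Rm n (i, a) (k, c) * Rm n (d, c) (b, e)) •
      (sg n t tb k b * sg n t tb e f) - sg n t tb i d * sg n t tb a f ∈ II • Gf AA gg dg PP D := by
    have e0 : sg n t tb i d * sg n t tb a f = ∑ k, ∑ c, ∑ b, ∑ e,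
        (if (i, a) = (k, c) ∧ (d, c) = (b, e) then (1 : F) else 0) •
        (sg n t tb k b * sg n t tb e f) := by
      simp only [Prod.mk.injEq, ite_and, ite_smul, one_smul, zero_smul, Finset.sum_ite_irrel,
        Finset.sum_ite_eq, Finset.mem_univ, if_true, Finset.sum_const_zero]
    rw [e0]
    simp only [← Finset.sum_sub_distrib, ← sub_smul]
    refine sum_mem fun k _ => sum_mem fun c _ => sum_mem fun b _ => sum_mem fun e _ => ?_
    by_cases z : Rm n (i, a) (k, c) * Rm n (d, c) (b, e) = 0 ∧ ¬ ((i, a) = (k, c) ∧ (d, c) = (b, e))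
    · rw [z.1, if_neg z.2]; simp
    · apply smul_mem_I _ (v_RR hv _ _ _ _)
      apply sMM h
      by_cases z1 : (i, a) = (k, c) ∧ (d, c) = (b, e)
      · simp only [Prod.mk.injEq] at z1
        obtain ⟨⟨rfl, rfl⟩, rfl, rfl⟩ := z1
        omega
      · have z2 : Rm n (i, a) (k, c) * Rm n (d, c) (b, e) ≠ 0 := fun hz => z ⟨hz, z1⟩
        have r1 := Rm_supp _ _ _ _ _ (left_ne_zero_of_mul z2)
        have r2 := Rm_supp _ _ _ _ _ (right_ne_zero_of_mul z2)
        simp only [Fin.le_def] at r1 r2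
        omega
  have h2 : ∑ c, ∑ k, ∑ e, ∑ m, (Rm n (k, c) (i, e) * Rm n (m, e) (d, f)) •
      (sg n t tb a c * sg n t tb k m) - sg n t tb a f * sg n t tb i d
      ∈ II • Gf AA gg dg PP D := by
    have e0 : sg n t tb a f * sg n t tb i d = ∑ c, ∑ k, ∑ e, ∑ m,
        (if (k, c) = (i, e) ∧ (m, e) = (d, f) then (1 : F) else 0) •
        (sg n t tb a c * sg n t tb k m) := by
      rw [Finset.sum_eq_single f, Finset.sum_eq_single i, Finset.sum_eq_single f,
        Finset.sum_eq_single d]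
      · simp
      all_goals first
        | (intro b _ hb; simp [hb]; done)
        | (intro b _ hb; simp [hb.symm]; done)
        | (simp; done)
        | (intro b _ hb
           refine Finset.sum_eq_zero fun x _ => Finset.sum_eq_zero fun y _ =>
             Finset.sum_eq_zero fun z _ => ?_
           rw [if_neg, zero_smul]
           simp only [Prod.mk.injEq]
           rintro ⟨⟨_, h1⟩, _, h2⟩
           exact hb (h1.trans h2))
    rw [e0]
    simp only [← Finset.sum_sub_distrib, ← sub_smul]
    refine sum_mem fun c _ => sum_mem fun k _ => sum_mem fun e _ => sum_mem fun m _ => ?_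
    by_cases z : Rm n (k, c) (i, e) * Rm n (m, e) (d, f) = 0 ∧ ¬ ((k, c) = (i, e) ∧ (m, e) = (d, f))
    · rw [z.1, if_neg z.2]; simp
    · apply smul_mem_I _ (v_RR hv _ _ _ _)
      apply sMM h
      by_cases z1 : (k, c) = (i, e) ∧ (m, e) = (d, f)
      · simp only [Prod.mk.injEq] at z1
        obtain ⟨⟨rfl, rfl⟩, rfl, rfl⟩ := z1
        omega
      · have z2 : Rm n (k, c) (i, e) * Rm n (m, e) (d, f) ≠ 0 := fun hz => z ⟨hz, z1⟩
        have r1 := Rm_supp _ _ _ _ _ (left_ne_zero_of_mul z2)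
        have r2 := Rm_supp _ _ _ _ _ (right_ne_zero_of_mul z2)
        simp only [Fin.le_def] at r1 r2
        omega
  have := sub_mem h2 h1
  rw [H] at this
  simpa using this

theorem sp_mem (hv : v (q - 1) < 1) (h : Rels n t tb) : ∀ (d : ℕ) (i a : Fin (2*n)),
    (a : ℕ) ≤ d + i → sp n t tb i a ∈ Gf AA gg dg PP d := by
  intro d
  induction d using Nat.strong_induction_on with
  | _ d ih =>
  intro i a hd
  rcases lt_or_ge a i with hia | hia
  · rw [sp_zero h hia]; exact zero_mem _
  have H := sp_lin h i a
  rw [← Fintype.sum_prod_type' (f := fun k c => Rm n (i, a) (k, c) • sp n t tb k c)] at H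
  rw [← Finset.add_sum_erase _ _ (Finset.mem_univ (i, a))] at H
  dsimp only at H
  have hu : v (Rm n (i, a) (i, a)) = 1 := by
    have h1 := v_Rm hv (i, a) (i, a)
    rw [if_pos rfl] at h1
    have : Rm n (i, a) (i, a) = 1 + (Rm n (i, a) (i, a) - 1) := by ring
    rw [this]
    exact Valuation.map_one_add_of_lt v h1
  have hne : Rm n (i, a) (i, a) ≠ 0 := by
    intro h0; rw [h0] at hu; simp at hu
  have e : sp n t tb i a = (Rm n (i, a) (i, a))⁻¹ • (Rm n (i, a) (i, a) • sp n t tb i a) := by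
    rw [smul_smul, inv_mul_cancel₀ hne, one_smul]
  rw [e, eq_sub_of_add_eq H]
  refine smul_mem_sub _ (by rw [map_inv₀, hu, inv_one]) (sub_mem
    (smul_mem_sub _ (v_q hv).le (sM h hd)) (sum_mem ?_))
  rintro ⟨k, c⟩ hkc
  by_cases z : Rm n (i, a) (k, c) = 0
  · rw [z, zero_smul]; exact zero_mem _
  have r := Rm_supp _ _ _ _ _ z
  have hne' : ¬ (k = i ∧ c = a) := by simpa using hkc
  have hki : (i : ℕ) < k := by
    rcases r.2.lt_or_eq with hh | hh
    · exact hh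
    · subst hh
      exact absurd ⟨rfl, Fin.ext (by have := r.1; omega)⟩ hne'
  apply smul_mem_sub _ (v_Rm_le hv _ _)
  rcases lt_or_ge c k with hck | hck
  · rw [sp_zero h hck]; exact zero_mem _
  rw [Fin.le_def] at hck
  refine Gf_mono gg dg (fun _ h => h) (?_ : (c : ℕ) - k ≤ d) (ih (c - k) ?_ k c ?_) <;> omega

theorem sp_sub (hv : v (q - 1) < 1) (h : Rels n t tb) (d : ℕ) (i a : Fin (2*n))
    (hd : (a : ℕ) ≤ d + i) : sp n t tb i a - sg n t tb a i ∈ II • Gf AA gg dg PP d := by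
  have H := sp_lin h i a
  rw [← Fintype.sum_prod_type' (f := fun k c => Rm n (i, a) (k, c) • sp n t tb k c)] at H
  have e0 : sp n t tb i a = ∑ p : Fin (2*n) × Fin (2*n),
      (if (i, a) = p then (1 : F) else 0) • sp n t tb p.1 p.2 := by
    simp
  have e1 : sp n t tb i a - sg n t tb a i = (q - 1) • sg n t tb a i
      - ∑ p : Fin (2*n) × Fin (2*n), (Rm n (i, a) p - if (i, a) = p then (1 : F) else 0) •
        sp n t tb p.1 p.2 := by
    simp only [sub_smul, Finset.sum_sub_distrib]
    rw [← e0, ← H, one_smul]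
    abel
  rw [e1]
  refine sub_mem (smul_mem_I _ hv (sM h hd)) (sum_mem ?_)
  rintro ⟨k, c⟩ _
  by_cases z : Rm n (i, a) (k, c) = 0 ∧ (i, a) ≠ (k, c)
  · rw [z.1, if_neg z.2]; simp
  apply smul_mem_I _ (v_Rm hv _ _)
  apply sp_mem hv h
  dsimp only
  by_cases z1 : (i, a) = (k, c)
  · simp only [Prod.mk.injEq] at z1
    obtain ⟨rfl, rfl⟩ := z1
    exact hd
  · have r := Rm_supp n i a k c (fun hz => z ⟨hz, z1⟩)
    simp only [Fin.le_def] at r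
    omega

theorem sym_mem (hv : v (q - 1) < 1) (h : Rels n t tb) (i c : Fin (2*n)) (hc : c < i)
    (ih : ∀ y : Fin (2*n) × Fin (2*n), PP y → dg y < dg (i, c) → gg y ∈ Ef II gg dg PP QQ (dg y)) :
    sg n t tb i c ∈ Ef II gg dg PP QQ ((i : ℕ) - c) := by
  by_cases hg : i ≤ pr n c
  · exact Submodule.mem_sup_left (Gf_gen gg dg QQ (x := (i, c)) ⟨hc, hg⟩ le_rfl)
  have hpi := pr_val n i
  have hpc := pr_val n c
  have hilt := i.isLt
  rw [Fin.le_def] at hg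
  rw [Fin.lt_def] at hc
  have H := sp_quad h i (pr n c) (by rw [pr_pr]; exact (Fin.ne_of_lt hc).symm)
  rw [← Finset.add_sum_erase _ _ (Finset.mem_univ c), sp_diag h] at H
  have e : sg n t tb i c = (- (dd n c)⁻¹) • ((dd n c * eps n c) • (sg n t tb i c *
      eps n (pr n c) • (1 : U))) := by
    rw [mul_smul_comm, mul_one, smul_smul, smul_smul, eps_pr]
    have : -(dd n c)⁻¹ * (dd n c * eps n c) * -eps n c = 1 := by
      have := dd_ne n c
      field_simp
      linear_combination eps_sq n c
    rw [this, one_smul]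
  rw [e, eq_neg_of_add_eq_zero_left H]
  refine smul_mem_sub _ (by rw [Valuation.map_neg, map_inv₀, v_dd hv, inv_one])
    (neg_mem (sum_mem ?_))
  intro j hj
  have hjc : j ≠ c := by simpa using hj
  refine smul_mem_sub _ (by rw [map_mul, v_dd hv, v_eps, one_mul]) ?_
  have hpj := pr_val n j
  have hjlt := j.isLt
  rcases lt_or_ge j c with h1 | h1
  · rw [sp_zero h ((pr_lt _ _ _).2 h1), mul_zero]; exact zero_mem _
  have h1' : (c : ℕ) < j := lt_of_le_of_ne h1 (fun hh => hjc (Fin.ext hh.symm))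
  rcases lt_trichotomy i j with h2 | h2 | h2
  · rw [sg_zero h h2, zero_mul]; exact zero_mem _
  · subst h2
    rw [sg_diag h, smul_mul_assoc, one_mul]
    refine smul_mem_sub _ (v_eps _).le ?_
    have e2 : sp n t tb (pr n i) (pr n c) = sg n t tb (pr n c) (pr n i)
      + (sp n t tb (pr n i) (pr n c) - sg n t tb (pr n c) (pr n i)) := by abel
    rw [e2]
    refine add_mem (Submodule.mem_sup_left (Gf_gen gg dg QQ (x := (pr n c, pr n i)) ⟨?_, ?_⟩ ?_))
      (Submodule.mem_sup_right (sp_sub hv h _ _ _ ?_))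
    · exact (pr_lt _ _ _).2 hc
    · dsimp only; rw [pr_pr, Fin.le_def]; omega
    · dsimp only; omega
    · omega
  · rw [Fin.lt_def] at h2
    have a1 := ih (i, j) h2 (by dsimp only; omega)
    have a2 := ih (pr n c, pr n j) ((pr_lt _ _ _).2 h1') (by dsimp only; omega)
    dsimp only at a1 a2
    have e2 : sp n t tb (pr n j) (pr n c) = sg n t tb (pr n c) (pr n j)
      + (sp n t tb (pr n j) (pr n c) - sg n t tb (pr n c) (pr n j)) := by abel
    have a3 : sp n t tb (pr n j) (pr n c) ∈ Ef II gg dg PP QQ ((pr n c : ℕ) - pr n j) := by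
      rw [e2]
      exact add_mem a2 (Submodule.mem_sup_right (sp_sub hv h _ _ _ (by omega)))
    refine Ef_mono II gg dg PP QQ ?_ (Ef_mul II gg dg (fun _ h => h.1) a1 a3)
    omega

end Part5
section Part6

theorem core {n : ℕ} {U : Type*} [Ring U] [Algebra F U]
    {Γ : Type*} [LinearOrderedCommGroupWithZero Γ] (v : Valuation F Γ)
    {t tb : Fin (2*n) → Fin (2*n) → U} (hv : v (q - 1) < 1) (h : Rels n t tb)
    (E : List (Fin (2*n) × Fin (2*n))) (hE : E.Nodup) (hEm : ∀ x, x ∈ E) :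
    Subalgebra.toSubmodule (Algebra.adjoin F
      (Set.range fun p : Fin (2*n) × Fin (2*n) => sg n t tb p.1 p.2)) ≤
    Submodule.span F {x | ∃ k : Fin (2*n) × Fin (2*n) → ℕ,
      (∀ y : Fin (2*n) × Fin (2*n), ¬ (y.2 < y.1 ∧ y.1 ≤ pr n y.2) → k y = 0) ∧
      x = (E.map fun y => sg n t tb y.1 y.2 ^ k y).prod} := by
  let _ : Algebra v.valuationSubring U := Algebra.compHom U (algebraMap v.valuationSubring F)
  have _ : IsScalarTower v.valuationSubring F U := IsScalarTower.of_algebraMap_smul fun _ _ => rfl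
  have P1 := part1 (A := v.valuationSubring) (IsLocalRing.maximalIdeal v.valuationSubring)
    (IsLocalRing.maximalIdeal_le_jacobson _)
    (fun p : Fin (2*n) × Fin (2*n) => sg n t tb p.1 p.2)
    (fun p : Fin (2*n) × Fin (2*n) => (p.1 : ℕ) - (p.2 : ℕ))
    (P := fun p : Fin (2*n) × Fin (2*n) => p.2 < p.1)
    (Q := fun p : Fin (2*n) × Fin (2*n) => p.2 < p.1 ∧ p.1 ≤ pr n p.2)
    (fun _ hx => hx.1) (fun x hx => by rw [Fin.lt_def] at hx; omega)
    (fun x y hx hy => comm_mem hv h x.1 x.2 y.1 y.2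
      (by rw [Fin.lt_def] at hx hy; omega))
    (fun x hx ih => sym_mem hv h x.1 x.2 hx ih) E hE hEm
  rw [Algebra.adjoin_eq_span, Submodule.span_le]
  intro x hx
  have key : ∃ d, x ∈ Gf v.valuationSubring
      (fun p : Fin (2*n) × Fin (2*n) => sg n t tb p.1 p.2)
      (fun p : Fin (2*n) × Fin (2*n) => (p.1 : ℕ) - (p.2 : ℕ))
      (fun p : Fin (2*n) × Fin (2*n) => p.2 < p.1) d := by
    refine Submonoid.closure_induction (motive := fun x _ => ∃ d, x ∈ Gf v.valuationSubring
      (fun p : Fin (2*n) × Fin (2*n) => sg n t tb p.1 p.2)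
      (fun p : Fin (2*n) × Fin (2*n) => (p.1 : ℕ) - (p.2 : ℕ))
      (fun p : Fin (2*n) × Fin (2*n) => p.2 < p.1) d) ?_ ?_ ?_ hx
    · rintro _ ⟨p, rfl⟩
      exact ⟨p.1, sM h (by omega)⟩
    · exact ⟨0, Gf_one _ _ _ _⟩
    · rintro x y _ _ ⟨d, hd⟩ ⟨e, he⟩
      exact ⟨d + e, Gf_mul _ _ _ hd he⟩
  obtain ⟨d, hd⟩ := key
  exact Submodule.span_le_restrictScalars v.valuationSubring F _ (P1 d hd)

theorem exists_val : ∃ (Γ : Type) (_ : LinearOrderedCommGroupWithZero Γ) (v : Valuation F Γ),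
    v (q - 1) < 1 := by
  let w : IsDedekindDomain.HeightOneSpectrum (Polynomial ℂ) :=
    ⟨Ideal.span {Polynomial.X - Polynomial.C 1},
      (Ideal.span_singleton_prime (Polynomial.X_sub_C_ne_zero 1)).2 (Polynomial.prime_X_sub_C 1),
      by rw [Ne, Ideal.span_singleton_eq_bot]; exact Polynomial.X_sub_C_ne_zero 1⟩
  refine ⟨_, inferInstance, w.valuation F, ?_⟩
  have e : q - 1 = algebraMap (Polynomial ℂ) F (Polynomial.X - Polynomial.C 1) := by
    simp [q]
  rw [e, IsDedekindDomain.HeightOneSpectrum.valuation_lt_one_iff_mem]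
  exact Ideal.mem_span_singleton_self _

theorem rels_U (n : ℕ) : Rels n (tU n) (tbU n) where
  t_upper i j h := by simpa [tU, tbU] using RingQuot.mkAlgHom_rel F (rel.t_upper i j h)
  tb_lower i j h := by simpa [tU, tbU] using RingQuot.mkAlgHom_rel F (rel.tb_lower i j h)
  t_tb_diag i := by simpa [tU, tbU] using RingQuot.mkAlgHom_rel F (rel.t_tb_diag i)
  tb_t_diag i := by simpa [tU, tbU] using RingQuot.mkAlgHom_rel F (rel.tb_t_diag i)
  rtt_tt i a j b := by
    simpa only [tU, tbU, map_sum, map_smul, map_mul] using RingQuot.mkAlgHom_rel F (rel.rtt_tt i a j b)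
  rtt_bb i a j b := by
    simpa only [tU, tbU, map_sum, map_smul, map_mul] using RingQuot.mkAlgHom_rel F (rel.rtt_bb i a j b)
  rtt_bt i a j b := by
    simpa only [tU, tbU, map_sum, map_smul, map_mul] using RingQuot.mkAlgHom_rel F (rel.rtt_bt i a j b)
  cent_t1 i j := by
    have := RingQuot.mkAlgHom_rel F (rel.cent_t1 i j)
    rw [apply_ite (RingQuot.mkAlgHom F (rel n))] at this
    simpa only [tU, tbU, map_sum, map_smul, map_mul, map_one, map_zero] using this
  cent_tb2 i j := by
    have := RingQuot.mkAlgHom_rel F (rel.cent_tb2 i j)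
    rw [apply_ite (RingQuot.mkAlgHom F (rel n))] at this
    simpa only [tU, tbU, map_sum, map_smul, map_mul, map_one, map_zero] using this

theorem sU_eq (n : ℕ) (i j : Fin (2*n)) : sU n i j = sg n (tU n) (tbU n) i j := by
  unfold sU sg
  apply Finset.sum_subset (Finset.subset_univ _)
  intro k _ hk
  rw [Finset.mem_Icc, not_and_or, not_le, not_le] at hk
  rcases hk with hk | hk
  · rw [(rels_U n).tb_lower _ _ hk, mul_zero, smul_zero]
  · rw [(rels_U n).t_upper _ _ hk, zero_mul, smul_zero]

theorem prod_product {M α β : Type*} [Monoid M] (l : List α) (m : List β) (f : α × β → M) :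
    ((l ×ˢ m).map f).prod = (l.map fun i => (m.map fun j => f (i, j)).prod).prod := by
  induction l with
  | nil => simp
  | cons a l ih =>
    rw [List.product_cons, List.map_append, List.prod_append, ih]
    simp [Function.comp_def]

end Part6

/-- the ordered monomials in the generators s_{ij}, 1 ≤ j < i ≤ j′,
    linearly span U_q^{tw}(gl_n) over F. -/
theorem monomials_span (n : ℕ) (hn : 2 ≤ n) :
    Submodule.span F {x : Usp n | ∃ k : Fin (2*n) × Fin (2*n) → ℕ, x = monomial n k}
      = Subalgebra.toSubmodule (Utw n) := by
  apply le_antisymm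
  · rw [Submodule.span_le]
    rintro _ ⟨k, rfl⟩
    change monomial n k ∈ Utw n
    unfold monomial
    apply list_prod_mem
    intro x hx
    obtain ⟨i, -, rfl⟩ := List.mem_map.1 hx
    apply list_prod_mem
    intro y hy
    obtain ⟨j, -, rfl⟩ := List.mem_map.1 hy
    split_ifs
    · have hs : sU n i j ∈ Utw n := Algebra.subset_adjoin ⟨(i, j), rfl⟩
      exact pow_mem hs _
    · exact one_mem _
  · obtain ⟨Γ, _, v, hv⟩ := exists_val
    have hc := core v hv (rels_U n) (List.finRange (2*n) ×ˢ List.finRange (2*n))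
      ((List.nodup_finRange _).product (List.nodup_finRange _))
      (fun x => List.mem_product.2 ⟨List.mem_finRange _, List.mem_finRange _⟩)
    simp only [← sU_eq] at hc
    refine le_trans hc (Submodule.span_mono ?_)
    rintro _ ⟨k, hk, rfl⟩
    refine ⟨k, ?_⟩
    rw [prod_product]
    unfold monomial
    congr 1
    apply List.map_congr_left
    intro i _
    congr 1
    apply List.map_congr_left
    intro j _
    split_ifs with hij
    · rfl
    · rw [hk (i, j) hij, pow_zero]

end CI
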